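/- Let 𝒳 : ℝ^{n×N} → ℝ^m be a linear map with n ≤ N, and let 1 ≤ r ≤ n. Then the following are equivalent: (a) for every matrix A ∈ ℝ^{n×N} with rank(A) ≤ r, A is the unique minimizer of the nuclear norm ‖Z‖_* over all Z ∈ ℝ^{n×N} satisfying 𝒳(Z) = 𝒳(A); (b) 𝒳 satisfies the rank-r null space property, i.e. ∑_{j=1}^r σ_j(M) < ∑_{j=r+1}^n σ_j(M) for every nonzero M in the kernel of 𝒳. -/

import Mathlib

open Matrix

/-- The rearrangement of a finite tuple of reals in nonincreasing order. -/
noncomputable def sortedDesc {d : ℕ} (f : Fin d → ℝ) : Fin d → ℝ :=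
  fun j => -(((fun i => -f i) ∘ (Tuple.sort fun i => -f i)) j)

/-- The singular values `σ₁(A) ≥ σ₂(A) ≥ … ≥ σ_n(A) ≥ 0` of a real `n × N` matrix,
in nonincreasing order: the square roots of the eigenvalues of `A * Aᵀ`. -/
noncomputable def singularValues {n N : ℕ} (A : Matrix (Fin n) (Fin N) ℝ) : Fin n → ℝ :=
  sortedDesc fun j => Real.sqrt ((Matrix.isHermitian_mul_conjTranspose_self A).eigenvalues j)

/-- **Weyl monotonicity** for symmetric operators: the sorted eigenvalues are monotone with respect
to the Loewner order. -/
theorem LinearMap.IsSymmetric.eigenvalues_le_eigenvalues {E : Type*} [NormedAddCommGroup E]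
    [InnerProductSpace ℝ E] [FiniteDimensional ℝ E] {n : ℕ} {S T : E →ₗ[ℝ] E}
    (hS : S.IsSymmetric) (hT : T.IsSymmetric) (hn : Module.finrank ℝ E = n)
    (h : ∀ x, inner ℝ (S x) x ≤ inner ℝ (T x) x) (i : Fin n) :
    hS.eigenvalues hn i ≤ hT.eigenvalues hn i := by
  have expand {R : E →ₗ[ℝ] E} (hR : R.IsSymmetric) (x : E) :
      inner ℝ (R x) x = ∑ j, hR.eigenvalues hn j * inner ℝ (hR.eigenvectorBasis hn j) x ^ 2 := by
    rw [← (hR.eigenvectorBasis hn).sum_inner_mul_inner (R x) x]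
    refine Finset.sum_congr rfl fun j _ => ?_
    rw [hR x, hR.apply_eigenvectorBasis hn j, RCLike.ofReal_real_eq_id, id_eq,
      inner_smul_right, real_inner_comm x]
    ring
  have normSq {R : E →ₗ[ℝ] E} (hR : R.IsSymmetric) (x : E) :
      ‖x‖ ^ 2 = ∑ j, inner ℝ (hR.eigenvectorBasis hn j) x ^ 2 := by
    rw [← (hR.eigenvectorBasis hn).sum_sq_norm_inner_right x]
    simp
  let L : E →ₗ[ℝ] ({j : Fin n // j ≠ i} → ℝ) := LinearMap.pi fun j =>
    (innerₗ E (if i < (j : Fin n) then hS.eigenvectorBasis hn j else hT.eigenvectorBasis hn j))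
  have hL : LinearMap.ker L ≠ ⊥ := by
    apply LinearMap.ker_ne_bot_of_finrank_lt
    have := i.pos
    simp [hn, Fintype.card_subtype_compl]
    omega
  obtain ⟨x, hx, hx0⟩ := Submodule.exists_mem_ne_zero_of_ne_bot hL
  have hx' (j : Fin n) (hj : j ≠ i) :
      inner ℝ (if i < j then hS.eigenvectorBasis hn j else hT.eigenvectorBasis hn j) x = 0 :=
    congrFun (LinearMap.mem_ker.1 hx) ⟨j, hj⟩
  have lower : hS.eigenvalues hn i * ‖x‖ ^ 2 ≤ inner ℝ (S x) x := by
    rw [expand hS, normSq hS, Finset.mul_sum]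
    refine Finset.sum_le_sum fun j _ => ?_
    rcases le_or_gt j i with hj | hj
    · exact mul_le_mul_of_nonneg_right (hS.eigenvalues_antitone hn hj) (sq_nonneg _)
    · have := hx' j hj.ne'
      rw [if_pos hj] at this
      simp [this]
  have upper : inner ℝ (T x) x ≤ hT.eigenvalues hn i * ‖x‖ ^ 2 := by
    rw [expand hT, normSq hT, Finset.mul_sum]
    refine Finset.sum_le_sum fun j _ => ?_
    rcases le_or_gt i j with hj | hj
    · exact mul_le_mul_of_nonneg_right (hT.eigenvalues_antitone hn hj) (sq_nonneg _)
    · have := hx' j hj.ne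
      rw [if_neg hj.not_gt] at this
      simp [this]
  have : 0 < ‖x‖ ^ 2 := by positivity
  exact le_of_mul_le_mul_right (lower.trans ((h x).trans upper)) this

namespace Matrix

/-- The Hermitian (Jordan–Wielandt) dilation of a real matrix. -/
def dilation {ι κ : Type*} (A : Matrix ι κ ℝ) : Matrix (ι ⊕ κ) (ι ⊕ κ) ℝ :=
  fromBlocks 0 A Aᴴ 0

theorem isHermitian_dilation {ι κ : Type*} (A : Matrix ι κ ℝ) : (dilation A).IsHermitian := by
  rw [dilation, IsHermitian, fromBlocks_conjTranspose]
  simp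

variable {ι κ : Type*} [Fintype ι] [DecidableEq ι] [Fintype κ] [DecidableEq κ]

theorem IsHermitian.eigenvalues_le_eigenvalues {A B : Matrix ι ι ℝ} (hA : A.IsHermitian)
    (hB : B.IsHermitian) (h : (B - A).PosSemidef) (i : ι) :
    hA.eigenvalues i ≤ hB.eigenvalues i := by
  refine LinearMap.IsSymmetric.eigenvalues_le_eigenvalues _ _ _ (fun x => ?_) _
  have := h.dotProduct_mulVec_nonneg x.ofLp
  rw [sub_mulVec, dotProduct_sub, sub_nonneg] at this
  simpa [EuclideanSpace.inner_eq_star_dotProduct] using this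

theorem IsHermitian.sum_map_eigenvalues {A : Matrix ι ι ℝ} (hA : A.IsHermitian) (f : ℝ → ℝ) :
    ∑ i, f (hA.eigenvalues i) = (A.charpoly.roots.map f).sum := by
  rw [hA.roots_charpoly_eq_eigenvalues, Multiset.map_map]
  rfl

/-- Every real Hermitian matrix is orthogonally diagonalizable. -/
theorem IsHermitian.exists_orthogonal_diagonalization {A : Matrix ι ι ℝ} (hA : A.IsHermitian) :
    ∃ U : Matrix ι ι ℝ, Uᴴ * U = 1 ∧ U * Uᴴ = 1 ∧ A = U * diagonal hA.eigenvalues * Uᴴ := by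
  refine ⟨hA.eigenvectorUnitary, ?_, ?_, ?_⟩
  · exact Unitary.coe_star_mul_self hA.eigenvectorUnitary
  · exact Unitary.coe_mul_star_self hA.eigenvectorUnitary
  · conv_lhs => rw [hA.spectral_theorem, Unitary.conjStarAlgAut_apply]
    rfl

theorem roots_charpoly_orthogonal_conj_diagonal {U : Matrix ι ι ℝ} (hU : Uᴴ * U = 1)
    (d : ι → ℝ) :
    (U * diagonal d * Uᴴ).charpoly.roots = Finset.univ.val.map d := by
  rw [charpoly_mul_comm, ← mul_assoc, hU, one_mul, charpoly_diagonal, Polynomial.roots_prod]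
  · simp
  · simp [Finset.prod_ne_zero_iff, Polynomial.X_sub_C_ne_zero]

/-- A Hermitian matrix is dominated by its positive part, whose trace is the sum of the positive
eigenvalues. -/
theorem IsHermitian.exists_posSemidef_majorant {A : Matrix ι ι ℝ} (hA : A.IsHermitian) :
    ∃ P : Matrix ι ι ℝ, P.PosSemidef ∧ (P - A).PosSemidef ∧
      P.trace = ∑ i, max (hA.eigenvalues i) 0 := by
  obtain ⟨U, hU, -, hAU⟩ := hA.exists_orthogonal_diagonalization
  refine ⟨U * diagonal (fun i => max (hA.eigenvalues i) 0) * Uᴴ, ?_, ?_, ?_⟩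
  · exact (PosSemidef.diagonal fun i => le_max_right _ _).mul_mul_conjTranspose_same U
  · have : U * diagonal (fun i => max (hA.eigenvalues i) 0) * Uᴴ - A =
        U * diagonal (fun i => max (hA.eigenvalues i) 0 - hA.eigenvalues i) * Uᴴ := by
      conv_lhs => enter [2]; rw [hAU]
      rw [← sub_mul, ← mul_sub, diagonal_sub]
    rw [this]
    exact (PosSemidef.diagonal fun i => sub_nonneg.2 (le_max_left _ _)).mul_mul_conjTranspose_same U
  · rw [trace_mul_comm, ← mul_assoc, hU, one_mul, trace_diagonal]

open Polynomial in
theorem charpoly_dilation_mul (A : Matrix ι κ ℝ) :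
    (dilation A).charpoly * X ^ Fintype.card ι =
      X ^ Fintype.card κ * (A * Aᴴ).charpoly.comp (X ^ 2) := by
  have hdet : (fromBlocks (scalar ι (X : ℝ[X])) 0 (Aᴴ.map C) (1 : Matrix κ κ ℝ[X])).det =
      X ^ Fintype.card ι := by
    simp
  have hcomp : ((A * Aᴴ).charpoly.comp (X ^ 2)) =
      (scalar ι (X ^ 2 : ℝ[X]) - (A * Aᴴ).map C).det := by
    generalize A * Aᴴ = B
    rw [charpoly, ← Polynomial.coe_compRingHom_apply, RingHom.map_det]
    congr 1
    ext i j : 2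
    by_cases h : i = j
    · subst h
      simp
    · simp [h]
  have hblock : (dilation A).charmatrix =
      fromBlocks (scalar ι (X : ℝ[X])) (-(A.map C)) (-(Aᴴ.map C)) (scalar κ X) := by
    rw [dilation, charmatrix_fromBlocks]
    simp [charmatrix]
  rw [← hdet, charpoly, ← det_mul, hblock, fromBlocks_multiply, hcomp]
  have : -(Aᴴ.map C) * scalar ι (X : ℝ[X]) + scalar κ (X : ℝ[X]) * Aᴴ.map C = 0 := by
    refine Matrix.ext fun i j => ?_
    rw [Matrix.add_apply, scalar_apply, scalar_apply, mul_diagonal, diagonal_mul, neg_apply,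
      zero_apply]
    ring
  rw [this]
  simp only [mul_one, det_fromBlocks_zero₂₁]
  rw [mul_comm]
  congr 1
  · simp
  · congr 1
    rw [Matrix.map_mul]
    simp [sq, sub_eq_add_neg]

/-- Spectral sums of the dilation, in terms of the singular values. -/
theorem sum_eigenvalues_dilation (A : Matrix ι κ ℝ) {f : ℝ → ℝ} (hf : f 0 = 0) :
    ∑ i, f ((isHermitian_dilation A).eigenvalues i) =
      ∑ j, (f √((isHermitian_mul_conjTranspose_self A).eigenvalues j) +
        f (-√((isHermitian_mul_conjTranspose_self A).eigenvalues j))) := by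
  set μ := (isHermitian_mul_conjTranspose_self A).eigenvalues with hμ
  have hcomp : (A * Aᴴ).charpoly.comp (Polynomial.X ^ 2) =
      ∏ j, ((Polynomial.X - Polynomial.C √(μ j)) * (Polynomial.X - Polynomial.C (-√(μ j)))) := by
    rw [(isHermitian_mul_conjTranspose_self A).charpoly_eq, Polynomial.prod_comp]
    refine Finset.prod_congr rfl fun j _ => ?_
    have hj : 0 ≤ μ j := (posSemidef_self_mul_conjTranspose A).eigenvalues_nonneg j
    simp only [Polynomial.sub_comp, Polynomial.X_comp, Polynomial.C_comp, Polynomial.C_neg,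
      RCLike.ofReal_real_eq_id, id, ← hμ]
    have hC : Polynomial.C (μ j) = Polynomial.C √(μ j) * Polynomial.C √(μ j) := by
      rw [← Polynomial.C_mul, Real.mul_self_sqrt hj]
    rw [hC]
    ring
  have hne : ∏ j, ((Polynomial.X - Polynomial.C √(μ j)) *
      (Polynomial.X - Polynomial.C (-√(μ j)))) ≠ 0 :=
    Finset.prod_ne_zero_iff.2 fun j _ =>
      mul_ne_zero (Polynomial.X_sub_C_ne_zero _) (Polynomial.X_sub_C_ne_zero _)
  have hroots := congrArg (fun p => (p.roots.map f).sum) (charpoly_dilation_mul A)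
  simp only [hcomp] at hroots
  rw [Polynomial.roots_mul (mul_ne_zero (charpoly_monic _).ne_zero
      (pow_ne_zero _ Polynomial.X_ne_zero)),
    Polynomial.roots_mul (mul_ne_zero (pow_ne_zero _ Polynomial.X_ne_zero) hne),
    Polynomial.roots_prod _ _ hne] at hroots
  simp only [Polynomial.roots_mul (mul_ne_zero (Polynomial.X_sub_C_ne_zero _)
    (Polynomial.X_sub_C_ne_zero _)), Polynomial.roots_X_sub_C, Polynomial.roots_X_pow,
    Multiset.map_add, Multiset.sum_add, Multiset.map_nsmul, Multiset.map_singleton, hf,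
    Multiset.sum_nsmul, Multiset.sum_singleton, smul_zero, add_zero, zero_add,
    Multiset.map_bind, Multiset.sum_bind] at hroots
  rw [(isHermitian_dilation A).sum_map_eigenvalues, hroots]
  rfl

/-- A Lidskii-type perturbation inequality: spectral sums of a nondecreasing function `f` such that
`x - f x` is nondecreasing change by at most the nuclear norm of the perturbation. -/
theorem sum_eigenvalues_dilation_add_le (A Z : Matrix ι κ ℝ) {f : ℝ → ℝ} (hf : Monotone f)
    (hf' : Monotone fun x => x - f x) :
    ∑ i, f ((isHermitian_dilation (A + Z)).eigenvalues i) ≤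
      ∑ i, f ((isHermitian_dilation A).eigenvalues i) +
        ∑ j, √((isHermitian_mul_conjTranspose_self Z).eigenvalues j) := by
  obtain ⟨P, hP, hPZ, htr⟩ := (isHermitian_dilation Z).exists_posSemidef_majorant
  have hE : (dilation A + P).IsHermitian := (isHermitian_dilation A).add hP.1
  have h₁ : ∀ i, (isHermitian_dilation (A + Z)).eigenvalues i ≤ hE.eigenvalues i := by
    refine IsHermitian.eigenvalues_le_eigenvalues _ _ ?_
    have : dilation (A + Z) = dilation A + dilation Z := by
      simp [dilation, fromBlocks_add]
    rwa [this, add_sub_add_left_eq_sub]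
  have h₂ : ∀ i, (isHermitian_dilation A).eigenvalues i ≤ hE.eigenvalues i := by
    refine IsHermitian.eigenvalues_le_eigenvalues _ _ ?_
    rwa [add_sub_cancel_left]
  have s₁ := Finset.sum_le_sum fun i (_ : i ∈ Finset.univ) => hf (h₁ i)
  have s₂ := Finset.sum_le_sum fun i (_ : i ∈ Finset.univ) => hf' (h₂ i)
  have tE := hE.trace_eq_sum_eigenvalues
  have tA := (isHermitian_dilation A).trace_eq_sum_eigenvalues
  rw [trace_add, htr, sum_eigenvalues_dilation Z (f := fun x => max x 0) (by simp)] at tE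
  simp only [Finset.sum_sub_distrib, RCLike.ofReal_real_eq_id, id] at s₂ tE tA
  have hZ : ∀ x : ℝ, max √x 0 + max (-√x) 0 = √x := fun x => by
    rw [max_eq_left (Real.sqrt_nonneg x), max_eq_right (neg_nonpos.2 (Real.sqrt_nonneg x)),
      add_zero]
  simp only [hZ] at tE
  linarith

end Matrix

section SingularValues

variable {n N : ℕ}

theorem sortedDesc_apply {d : ℕ} (f : Fin d → ℝ) (j : Fin d) :
    sortedDesc f j = f (Tuple.sort (fun i => -f i) j) := by
  simp [sortedDesc]

theorem sortedDesc_antitone {d : ℕ} (f : Fin d → ℝ) : Antitone (sortedDesc f) :=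
  fun _ _ hij => neg_le_neg (Tuple.monotone_sort (fun i => -f i) hij)

theorem sum_sortedDesc {d : ℕ} (f : Fin d → ℝ) (g : ℝ → ℝ) :
    ∑ j, g (sortedDesc f j) = ∑ j, g (f j) := by
  simp only [sortedDesc_apply]
  exact Equiv.sum_comp (Tuple.sort fun i => -f i) fun j => g (f j)

theorem singularValues_antitone (A : Matrix (Fin n) (Fin N) ℝ) : Antitone (singularValues A) :=
  sortedDesc_antitone _

theorem singularValues_nonneg (A : Matrix (Fin n) (Fin N) ℝ) (j : Fin n) :
    0 ≤ singularValues A j := by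
  rw [singularValues, sortedDesc_apply]
  exact Real.sqrt_nonneg _

theorem sum_map_singularValues (A : Matrix (Fin n) (Fin N) ℝ) (g : ℝ → ℝ) :
    ∑ j, g (singularValues A j) =
      ∑ j, g √((isHermitian_mul_conjTranspose_self A).eigenvalues j) :=
  sum_sortedDesc _ g

theorem card_singularValues_ne_zero (A : Matrix (Fin n) (Fin N) ℝ) :
    (Finset.univ.filter fun j => singularValues A j ≠ 0).card = A.rank := by
  rw [← rank_self_mul_conjTranspose,
    (isHermitian_mul_conjTranspose_self A).rank_eq_card_non_zero_eigs, Fintype.card_subtype]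
  have h := sum_map_singularValues A fun x => if x ≠ 0 then 1 else 0
  simp only [Finset.sum_boole, Nat.cast_inj] at h
  rw [h]
  congr 1
  refine Finset.filter_congr fun j _ => ?_
  rw [ne_eq, ne_eq, Real.sqrt_eq_zero
    ((posSemidef_self_mul_conjTranspose A).eigenvalues_nonneg j)]

/-- The Lidskii-type inequality `sum_eigenvalues_dilation_add_le` for singular values. -/
theorem sum_map_singularValues_add_le (A Z : Matrix (Fin n) (Fin N) ℝ) {f : ℝ → ℝ} (hf₀ : f 0 = 0)
    (hf : Monotone f) (hf' : Monotone fun x => x - f x) :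
    ∑ j, (f (singularValues (A + Z) j) + f (-singularValues (A + Z) j)) ≤
      ∑ j, (f (singularValues A j) + f (-singularValues A j)) + ∑ j, singularValues Z j := by
  have h := sum_eigenvalues_dilation_add_le A Z hf hf'
  rw [sum_eigenvalues_dilation _ hf₀, sum_eigenvalues_dilation _ hf₀] at h
  rw [sum_map_singularValues _ fun x => f x + f (-x), sum_map_singularValues _ fun x => f x + f (-x),
    sum_map_singularValues Z fun x => x]
  exact h

/-- Rescaling the terms of a singular value decomposition of `M` by the entries of `c`. -/
theorem exists_singular_rescaling (M : Matrix (Fin n) (Fin N) ℝ) :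
    ∃ R : (Fin n → ℝ) → Matrix (Fin n) (Fin N) ℝ,
      (∀ c d, R c - R d = R (c - d)) ∧ R 1 = M ∧
      (∀ c, (R c).rank ≤ (Finset.univ.filter fun j => c j ≠ 0).card) ∧
      ∀ c, ∑ j, singularValues (R c) j = ∑ j, |c j| * singularValues M j := by
  obtain ⟨U, hU, hU', hMU⟩ :=
    (isHermitian_mul_conjTranspose_self M).exists_orthogonal_diagonalization
  set μ := (isHermitian_mul_conjTranspose_self M).eigenvalues with hμ
  set e := Tuple.sort fun i => -√(μ i) with he
  refine ⟨fun c => U * diagonal (c ∘ e.symm) * Uᴴ * M, fun c d => ?_, ?_, fun c => ?_, fun c => ?_⟩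
  · beta_reduce
    rw [← Matrix.sub_mul, ← sub_mul, ← mul_sub, diagonal_sub]
    rfl
  · have : diagonal ((1 : Fin n → ℝ) ∘ e.symm) = 1 := diagonal_one
    beta_reduce
    rw [this, mul_one, hU', Matrix.one_mul]
  · refine (rank_mul_le_left _ _).trans ((rank_mul_le_left _ _).trans
      ((rank_mul_le_right _ _).trans ?_))
    rw [rank_diagonal, Fintype.card_subtype]
    refine (Finset.card_bij (fun i _ => e.symm i) ?_ ?_ ?_).le
    · simp
    · simp
    · intro j hj
      exact ⟨e j, by simpa using hj, by simp⟩
  · have hprod : (U * diagonal (c ∘ e.symm) * Uᴴ * M) * (U * diagonal (c ∘ e.symm) * Uᴴ * M)ᴴ =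
        U * diagonal (fun j => c (e.symm j) ^ 2 * μ j) * Uᴴ := by
      have hdiag : diagonal (fun j => c (e.symm j) ^ 2 * μ j) =
          diagonal (c ∘ e.symm) * diagonal μ * diagonal (c ∘ e.symm) := by
        simp only [diagonal_mul_diagonal, Function.comp]
        congr 1
        ext j
        ring
      calc _ = U * diagonal (c ∘ e.symm) * Uᴴ * (M * Mᴴ) * (U * diagonal (c ∘ e.symm) * Uᴴ) := by
            simp only [conjTranspose_mul, conjTranspose_conjTranspose, diagonal_conjTranspose,
              star_trivial, Matrix.mul_assoc]
        _ = U * diagonal (c ∘ e.symm) * (Uᴴ * U) * diagonal μ * (Uᴴ * U) *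
              diagonal (c ∘ e.symm) * Uᴴ := by
            rw [hMU]
            simp only [Matrix.mul_assoc]
        _ = _ := by
            rw [hU, hdiag]
            simp only [Matrix.mul_assoc, Matrix.mul_one]
    rw [sum_map_singularValues _ fun x => x,
      (isHermitian_mul_conjTranspose_self _).sum_map_eigenvalues Real.sqrt, hprod,
      roots_charpoly_orthogonal_conj_diagonal hU]
    simp only [singularValues, sortedDesc_apply, ← hμ, ← he]
    rw [← Equiv.sum_comp e.symm fun j => |c j| * √(μ (e j))]
    simp only [Equiv.apply_symm_apply, Multiset.map_map]
    refine Finset.sum_congr rfl fun j _ => ?_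
    rw [Function.comp_apply, Real.sqrt_mul (sq_nonneg _), Real.sqrt_sq_eq_abs]

/-- If `A` has rank at most `r`, then adding `M` changes the nuclear norm by at least the sum of
the tail singular values of `M` minus the sum of the leading ones. -/
theorem nuclearNorm_add_tail_le {r : ℕ} (hr1 : 1 ≤ r) (hrn : r ≤ n)
    (A Z : Matrix (Fin n) (Fin N) ℝ) (hA : A.rank ≤ r) :
    ∑ j, singularValues A j +
        ∑ j ∈ Finset.univ.filter (fun j : Fin n => r ≤ (j : ℕ)), singularValues (A + Z) j ≤
      ∑ j, singularValues Z j +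
        ∑ j ∈ Finset.univ.filter (fun j : Fin n => (j : ℕ) < r), singularValues (A + Z) j := by
  set M := A + Z with hM
  set t := singularValues M ⟨r - 1, by omega⟩ with ht
  have ht0 : 0 ≤ t := singularValues_nonneg _ _
  let f : ℝ → ℝ := fun x => min (max x 0) t + min (x + t) 0
  have hf₀ : f 0 = 0 := by simp [f, ht0]
  have hf : Monotone f := by
    intro x y hxy
    simp only [f]
    gcongr
  have hf' : Monotone fun x => x - f x := by
    intro x y hxy
    simp only [f]
    grind
  have key := sum_map_singularValues_add_le A Z hf₀ hf hf'
  have hsmall : ∀ x, 0 ≤ x → x ≤ t → f x + f (-x) = x := by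
    intro x h0 hx
    simp only [f]
    grind
  have hlarge : ∀ x, t ≤ x → f x + f (-x) = 2 * t - x := by
    intro x hx
    simp only [f]
    grind
  have hMsum : ∑ j, (f (singularValues M j) + f (-singularValues M j)) =
      2 * t * r - ∑ j ∈ Finset.univ.filter (fun j : Fin n => (j : ℕ) < r), singularValues M j +
        ∑ j ∈ Finset.univ.filter (fun j : Fin n => r ≤ (j : ℕ)), singularValues M j := by
    rw [← Finset.sum_filter_add_sum_filter_not _ fun j : Fin n => (j : ℕ) < r]
    simp only [not_lt]
    congr 1
    · rw [Finset.sum_congr rfl fun j hj => hlarge _ (singularValues_antitone M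
        (Fin.le_def.2 (Nat.le_sub_one_of_lt (Finset.mem_filter.1 hj).2))), Finset.sum_sub_distrib]
      have hcard : (Finset.univ.filter fun j : Fin n => (j : ℕ) < r).card = r := by
        simp [Fin.card_filter_val_lt, hrn]
      simp [hcard, mul_comm]
    · refine Finset.sum_congr rfl fun j hj => hsmall _ (singularValues_nonneg _ _)
        (singularValues_antitone M (Fin.le_def.2 ?_))
      exact (Nat.sub_le r 1).trans (Finset.mem_filter.1 hj).2
  have hAsum : ∑ j, (f (singularValues A j) + f (-singularValues A j)) + ∑ j, singularValues A j ≤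
      2 * t * r := by
    rw [← Finset.sum_add_distrib]
    have hle : ∀ j, f (singularValues A j) + f (-singularValues A j) + singularValues A j ≤
        if singularValues A j ≠ 0 then 2 * t else 0 := by
      intro j
      split_ifs with h
      · rcases le_total (singularValues A j) t with h' | h'
        · rw [hsmall _ (singularValues_nonneg _ _) h']
          linarith
        · rw [hlarge _ h']
          linarith
      · rw [not_not.1 h]
        simp [hf₀]
    refine (Finset.sum_le_sum fun j _ => hle j).trans ?_
    rw [← Finset.sum_filter, Finset.sum_const, card_singularValues_ne_zero, nsmul_eq_mul, mul_comm]
    have : (A.rank : ℝ) ≤ r := by exact_mod_cast hA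
    gcongr
  rw [hMsum] at key
  linarith

theorem singularValues_neg (A : Matrix (Fin n) (Fin N) ℝ) :
    singularValues (-A) = singularValues A := by
  have h : (-A) * (-A)ᴴ = A * Aᴴ := by simp
  simp only [singularValues, h]

end SingularValues

/-- Every matrix `A` of rank at most `r` is the unique minimizer of the nuclear norm
`‖Z‖_*` subject to `𝒳(Z) = 𝒳(A)` if, and only if, the linear information map `𝒳`
satisfies the rank-`r` null space property. -/
theorem nuclearNorm_recovery_iff_rank_NSP {n N m : ℕ} (hnN : n ≤ N) (r : ℕ)
    (hr1 : 1 ≤ r) (hrn : r ≤ n)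
    (X : Matrix (Fin n) (Fin N) ℝ →ₗ[ℝ] (Fin m → ℝ)) :
    (∀ A : Matrix (Fin n) (Fin N) ℝ, A.rank ≤ r →
        ∀ Z : Matrix (Fin n) (Fin N) ℝ, X Z = X A → Z ≠ A →
          ∑ j, singularValues A j < ∑ j, singularValues Z j)
      ↔ (∀ M : Matrix (Fin n) (Fin N) ℝ, M ≠ 0 → X M = 0 →
          ∑ j ∈ Finset.univ.filter (fun j : Fin n => (j : ℕ) < r), singularValues M j
            < ∑ j ∈ Finset.univ.filter (fun j : Fin n => r ≤ (j : ℕ)), singularValues M j) := by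
  constructor
  · intro h M hM0 hXM
    obtain ⟨R, hsub, hone, hrank, hsum⟩ := exists_singular_rescaling M
    let a : Fin n → ℝ := fun j => if (j : ℕ) < r then 1 else 0
    let z : Fin n → ℝ := fun j => if r ≤ (j : ℕ) then -1 else 0
    have haz : R a - R z = M := by
      rw [hsub, ← hone]
      congr 1
      ext j
      by_cases hj : (j : ℕ) < r
      · simp [a, z, hj]
      · simp [a, z, hj, not_lt.1 hj]
    have hra : (R a).rank ≤ r := by
      refine (hrank a).trans ?_
      simp [a, Fin.card_filter_val_lt]
    have hX : X (R z) = X (R a) := by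
      rw [eq_comm, ← sub_eq_zero, ← map_sub, haz, hXM]
    have hne : R z ≠ R a := fun e => hM0 (by rw [← haz, e, sub_self])
    have := h (R a) hra (R z) hX hne
    rw [hsum, hsum] at this
    simpa [a, z, apply_ite abs, ite_mul, Finset.sum_filter] using this
  · intro h A hA Z hXZ hZA
    have hN := h (A - Z) (sub_ne_zero.2 hZA.symm) (by rw [map_sub, hXZ, sub_self])
    have := nuclearNorm_add_tail_le hr1 hrn A (-Z) hA
    rw [singularValues_neg, ← sub_eq_add_neg] at this
    linarith
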